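/- Let I ⊂ ℝ be a bounded interval, V ∈ L^∞(I,ℝ), s ∈ ℝ, λ₁ the first Dirichlet eigenvalue of −∂_{xx} on I, f ∈ L²(I,ℂ), and u ∈ H² ∩ H₀¹(I,ℂ) a solution of −u'' − λ₁ u + i(V − s)u = f. Write u = C₁ e₁ + v with C₁ = ⟨u, e₁⟩ and v ⊥ e₁, where e₁ is the first normalized Dirichlet eigenfunction and λ₂ the second Dirichlet eigenvalue. Then ‖v‖² ≤ ‖f‖‖u‖/(λ₂ − λ₁) and ‖v'‖² ≤ (1 − λ₁/λ₂)^{−1}‖f‖‖u‖. -/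

import Mathlib

open MeasureTheory
open scoped Real

/-- First normalized Dirichlet eigenfunction of the Laplacian on `[a,b]`. -/
noncomputable def e1 (a b x : ℝ) : ℝ :=
  Real.sqrt (2 / (b - a)) * Real.sin (π * (x - a) / (b - a))

/-- Derivative of the first normalized Dirichlet eigenfunction. -/
noncomputable def e1' (a b x : ℝ) : ℝ :=
  Real.sqrt (2 / (b - a)) * (π / (b - a)) * Real.cos (π * (x - a) / (b - a))

theorem aux_wirt1 (p q k : ℝ) (hpq : p < q) (hk0 : 0 < k) (hk : k * (q - p) < π)
    (w w' : ℝ → ℂ) (hw : ∀ x ∈ Set.Icc p q, HasDerivAt w (w' x) x)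
    (hc : ContinuousOn w' (Set.Icc p q)) (hp : w p = 0) (hq : w q = 0) :
    k ^ 2 * ∫ x in p..q, ‖w x‖ ^ 2 ≤ ∫ x in p..q, ‖w' x‖ ^ 2 := by
  have hwc : ContinuousOn w (Set.Icc p q) := fun x hx => (hw x hx).continuousAt.continuousWithinAt
  set m := (p + q) / 2 with hm
  have hcos : ∀ x ∈ Set.Icc p q, Real.cos (k * (x - m)) ≠ 0 := by
    intro x hx
    apply ne_of_gt
    apply Real.cos_pos_of_mem_Ioo
    constructor
    · nlinarith [hx.1, mul_le_mul_of_nonneg_left hx.1 hk0.le]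
    · nlinarith [hx.2, mul_le_mul_of_nonneg_left hx.2 hk0.le]
  have htan : ContinuousOn (fun x => Real.tan (k * (x - m))) (Set.Icc p q) := by
    intro x hx
    have h1 : ContinuousAt Real.tan (k * (x - m)) := Real.continuousAt_tan.2 (hcos x hx)
    have h2 : ContinuousAt (fun x : ℝ => k * (x - m)) x := by fun_prop
    exact (ContinuousAt.comp (f := fun x : ℝ => k * (x - m)) h1 h2).continuousWithinAt
  let G' : ℝ → ℝ := fun x => -(k * ((1 + Real.tan (k * (x - m)) ^ 2) * k)) * ‖w x‖ ^ 2
      + (-(k * Real.tan (k * (x - m)))) * (2 * inner ℝ (w x) (w' x))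
  have hG : ∀ x ∈ Set.Icc p q,
      HasDerivAt (fun x => (-(k * Real.tan (k * (x - m)))) * ‖w x‖ ^ 2) (G' x) x := by
    intro x hx
    have h0 : HasDerivAt (fun x : ℝ => k * (x - m)) k x := by
      simpa using ((hasDerivAt_id x).sub_const m).const_mul k
    have h1 : HasDerivAt (fun x : ℝ => Real.tan (k * (x - m)))
        ((1 + Real.tan (k * (x - m)) ^ 2) * k) x := by
      have := (Real.hasDerivAt_tan (hcos x hx)).comp x h0
      rw [← Real.inv_one_add_tan_sq (hcos x hx)] at this
      rw [one_div, inv_inv] at this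
      exact this
    exact ((h1.const_mul k).neg).mul (hw x hx).norm_sq
  have hG'c : ContinuousOn G' (Set.Icc p q) := by
    have : ContinuousOn (fun x => inner ℝ (w x) (w' x)) (Set.Icc p q) := hwc.inner hc
    fun_prop
  have hu : Set.uIcc p q = Set.Icc p q := Set.uIcc_of_le hpq.le
  have hGi : IntervalIntegrable G' volume p q := (hu ▸ hG'c).intervalIntegrable
  have hint : ∫ x in p..q, G' x = 0 := by
    rw [intervalIntegral.integral_eq_sub_of_hasDerivAt (fun x hx => hG x (hu ▸ hx)) hGi]
    simp [hp, hq]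
  have i1 : IntervalIntegrable (fun x => ‖w x‖ ^ 2) volume p q :=
    ContinuousOn.intervalIntegrable (by rw [hu]; fun_prop)
  have i2 : IntervalIntegrable (fun x => ‖w' x‖ ^ 2) volume p q :=
    ContinuousOn.intervalIntegrable (by rw [hu]; fun_prop)
  have key : ∫ x in p..q, (k ^ 2 * ‖w x‖ ^ 2 + G' x) ≤ ∫ x in p..q, ‖w' x‖ ^ 2 := by
    apply intervalIntegral.integral_mono_on hpq.le ((i1.const_mul _).add hGi) i2
    intro x hx
    have h := sq_nonneg ‖w' x + (k * Real.tan (k * (x - m))) • w x‖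
    rw [norm_add_sq_real, norm_smul, inner_smul_right, real_inner_comm, mul_pow, Real.norm_eq_abs,
      sq_abs] at h
    simp only [G']
    nlinarith [h]
  rw [intervalIntegral.integral_add (i1.const_mul _) hGi, hint,
    intervalIntegral.integral_const_mul] at key
  linarith

theorem aux_wirt (p q k : ℝ) (hpq : p < q) (hk0 : 0 < k) (hk : k * (q - p) = π)
    (w w' : ℝ → ℂ) (hw : ∀ x ∈ Set.Icc p q, HasDerivAt w (w' x) x)
    (hc : ContinuousOn w' (Set.Icc p q)) (hp : w p = 0) (hq : w q = 0) :
    k ^ 2 * ∫ x in p..q, ‖w x‖ ^ 2 ≤ ∫ x in p..q, ‖w' x‖ ^ 2 := by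
  have ht : Filter.Tendsto (fun t : ℝ => t ^ 2 * ∫ x in p..q, ‖w x‖ ^ 2) (nhdsWithin k (Set.Iio k))
      (nhds (k ^ 2 * ∫ x in p..q, ‖w x‖ ^ 2)) := by
    have : Continuous (fun t : ℝ => t ^ 2 * ∫ x in p..q, ‖w x‖ ^ 2) := by fun_prop
    exact this.continuousAt.tendsto.mono_left nhdsWithin_le_nhds
  refine le_of_tendsto ht ?_
  filter_upwards [Ioo_mem_nhdsLT hk0] with t ht
  refine aux_wirt1 p q t hpq ht.1 ?_ w w' hw hc hp hq
  rw [← hk]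
  exact mul_lt_mul_of_pos_right ht.2 (by linarith)

theorem aux_expand (a b : ℝ) (hab : a < b) (g : ℝ → ℂ) (h : ℝ → ℝ) (d : ℂ)
    (hg : ContinuousOn g (Set.Icc a b)) (hh : Continuous h) :
    ∫ x in a..b, ‖g x - d * ((h x : ℝ) : ℂ)‖ ^ 2 =
      (∫ x in a..b, ‖g x‖ ^ 2) - 2 * inner ℝ d (∫ x in a..b, g x * ((h x : ℝ) : ℂ))
        + ‖d‖ ^ 2 * ∫ x in a..b, h x ^ 2 := by
  have hu : Set.uIcc a b = Set.Icc a b := Set.uIcc_of_le hab.le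
  have i1 : IntervalIntegrable (fun x => ‖g x‖ ^ 2) volume a b :=
    ContinuousOn.intervalIntegrable (by rw [hu]; fun_prop)
  have hgh : ContinuousOn (fun x => g x * ((h x : ℝ) : ℂ)) (Set.Icc a b) :=
    hg.mul (Complex.continuous_ofReal.comp hh).continuousOn
  have i2 : IntervalIntegrable (fun x => g x * ((h x : ℝ) : ℂ)) volume a b :=
    ContinuousOn.intervalIntegrable (by rw [hu]; exact hgh)
  have i3 : IntervalIntegrable (fun x => h x ^ 2) volume a b :=
    (by fun_prop : Continuous fun x => h x ^ 2).intervalIntegrable a b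
  have i4 : IntervalIntegrable (fun x => inner ℝ d (g x * ((h x : ℝ) : ℂ))) volume a b :=
    ContinuousOn.intervalIntegrable (by rw [hu]; exact continuousOn_const.inner hgh)
  have e : inner ℝ d (∫ x in a..b, g x * ((h x : ℝ) : ℂ)) =
      ∫ x in a..b, inner ℝ d (g x * ((h x : ℝ) : ℂ)) :=
    ((innerSL ℝ d).intervalIntegral_comp_comm i2).symm
  rw [e, ← intervalIntegral.integral_const_mul, ← intervalIntegral.integral_const_mul,
    ← intervalIntegral.integral_sub i1 (i4.const_mul _),
    ← intervalIntegral.integral_add (i1.sub (i4.const_mul _)) (i3.const_mul _)]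
  congr 1
  ext x
  simp only [Complex.inner, ← Complex.normSq_eq_norm_sq, Complex.normSq_apply]
  simp
  ring

theorem aux_cs (a b : ℝ) (hab : a < b) (f u : ℝ → ℂ)
    (hf : ContinuousOn f (Set.Icc a b)) (hu0 : ContinuousOn u (Set.Icc a b)) :
    ∫ x in a..b, inner ℝ (u x) (f x) ≤
      Real.sqrt (∫ x in a..b, ‖f x‖ ^ 2) * Real.sqrt (∫ x in a..b, ‖u x‖ ^ 2) := by
  have hu : Set.uIcc a b = Set.Icc a b := Set.uIcc_of_le hab.le
  have i1 : IntervalIntegrable (fun x => ‖f x‖ ^ 2) volume a b :=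
    ContinuousOn.intervalIntegrable (by rw [hu]; fun_prop)
  have i2 : IntervalIntegrable (fun x => ‖u x‖ ^ 2) volume a b :=
    ContinuousOn.intervalIntegrable (by rw [hu]; fun_prop)
  have i3 : IntervalIntegrable (fun x => inner ℝ (u x) (f x)) volume a b :=
    ContinuousOn.intervalIntegrable (by rw [hu]; exact hu0.inner hf)
  set P := ∫ x in a..b, inner ℝ (u x) (f x)
  set F := ∫ x in a..b, ‖f x‖ ^ 2
  set A := ∫ x in a..b, ‖u x‖ ^ 2
  have hF : 0 ≤ F := intervalIntegral.integral_nonneg hab.le fun x _ => sq_nonneg _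
  have h : ∀ t : ℝ, 0 ≤ A * (t * t) + (2 * P) * t + F := by
    intro t
    have h0 : 0 ≤ ∫ x in a..b, ‖t • u x + f x‖ ^ 2 :=
      intervalIntegral.integral_nonneg hab.le fun x _ => sq_nonneg _
    have e : ∫ x in a..b, ‖t • u x + f x‖ ^ 2 =
        ∫ x in a..b, (t * t * ‖u x‖ ^ 2 + 2 * t * inner ℝ (u x) (f x) + ‖f x‖ ^ 2) := by
      congr 1
      ext x
      rw [norm_add_sq_real, norm_smul, inner_smul_left, mul_pow, Real.norm_eq_abs, sq_abs]
      simp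
      ring
    rw [e, intervalIntegral.integral_add ((i2.const_mul _).add (i3.const_mul _)) i1,
      intervalIntegral.integral_add (i2.const_mul _) (i3.const_mul _),
      intervalIntegral.integral_const_mul, intervalIntegral.integral_const_mul] at h0
    change 0 ≤ t * t * A + 2 * t * P + F at h0
    linarith
  have hd := discrim_le_zero h
  rw [discrim] at hd
  rw [← Real.sqrt_mul hF]
  exact Real.le_sqrt_of_sq_le (by nlinarith)

theorem aux_e1_deriv (a b x : ℝ) : HasDerivAt (e1 a b) (e1' a b x) x := by
  have h0 : HasDerivAt (fun x : ℝ => π * (x - a) / (b - a)) (π / (b - a)) x := by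
    simpa using (((hasDerivAt_id x).sub_const a).const_mul π).div_const (b - a)
  have := (h0.sin).const_mul (Real.sqrt (2 / (b - a)))
  unfold e1'
  refine HasDerivAt.congr_deriv this ?_
  ring

theorem aux_e1'_deriv (a b x : ℝ) :
    HasDerivAt (e1' a b) (-(π ^ 2 / (b - a) ^ 2) * e1 a b x) x := by
  have h0 : HasDerivAt (fun x : ℝ => π * (x - a) / (b - a)) (π / (b - a)) x := by
    simpa using (((hasDerivAt_id x).sub_const a).const_mul π).div_const (b - a)
  have := (h0.cos).const_mul (Real.sqrt (2 / (b - a)) * (π / (b - a)))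
  unfold e1
  refine HasDerivAt.congr_deriv this ?_
  rw [← div_pow]
  ring

theorem aux_e1_c (a b : ℝ) : Continuous (e1 a b) :=
  continuous_iff_continuousAt.2 fun x => (aux_e1_deriv a b x).continuousAt

theorem aux_e1'_c (a b : ℝ) : Continuous (e1' a b) :=
  continuous_iff_continuousAt.2 fun x => (aux_e1'_deriv a b x).continuousAt

theorem aux_e1_a (a b : ℝ) : e1 a b a = 0 := by simp [e1]

theorem aux_e1_b (a b : ℝ) (hab : a < b) : e1 a b b = 0 := by
  have : b - a ≠ 0 := by linarith
  simp [e1, mul_div_assoc, div_self this]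

theorem aux_norms (a b : ℝ) (hab : a < b) :
    (∫ x in a..b, e1 a b x ^ 2) = 1 ∧ (∫ x in a..b, e1' a b x ^ 2) = π ^ 2 / (b - a) ^ 2 := by
  have hL : b - a ≠ 0 := by linarith
  have hc := aux_e1_c a b
  have hc' := aux_e1'_c a b
  have i1 : IntervalIntegrable (fun x => e1 a b x ^ 2) volume a b :=
    (by fun_prop : Continuous fun x => e1 a b x ^ 2).intervalIntegrable a b
  have i2 : IntervalIntegrable (fun x => e1' a b x ^ 2) volume a b :=
    (by fun_prop : Continuous fun x => e1' a b x ^ 2).intervalIntegrable a b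
  have h1 : ∫ x in a..b, e1' a b x ^ 2 =
      ∫ x in a..b, (π ^ 2 / (b - a) ^ 2) * ((2 / (b - a)) - e1 a b x ^ 2) := by
    congr 1
    ext x
    have hs : Real.sqrt (2 / (b - a)) ^ 2 = 2 / (b - a) :=
      Real.sq_sqrt (div_nonneg (by norm_num) (by linarith))
    simp only [e1, e1', mul_pow, hs, Real.cos_sq', div_pow]
    ring
  rw [intervalIntegral.integral_const_mul, intervalIntegral.integral_sub (by simp) i1,
    intervalIntegral.integral_const, smul_eq_mul, mul_div_cancel₀ _ hL] at h1
  have h2 : ∫ x in a..b, (e1' a b x ^ 2 - π ^ 2 / (b - a) ^ 2 * e1 a b x ^ 2) = 0 := by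
    have := intervalIntegral.integral_eq_sub_of_hasDerivAt (a := a) (b := b)
      (f := fun x => e1 a b x * e1' a b x)
      (f' := fun x => e1' a b x ^ 2 - π ^ 2 / (b - a) ^ 2 * e1 a b x ^ 2)
      (fun x _ => by
        refine ((aux_e1_deriv a b x).mul (aux_e1'_deriv a b x)).congr_deriv ?_
        ring) (i2.sub (i1.const_mul _))
    rw [this]
    simp [aux_e1_a, aux_e1_b a b hab]
  rw [intervalIntegral.integral_sub i2 (i1.const_mul _),
    intervalIntegral.integral_const_mul] at h2
  have hm : π ^ 2 / (b - a) ^ 2 ≠ 0 := by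
    have := Real.pi_pos
    positivity
  have h3 : (∫ x in a..b, e1 a b x ^ 2) = 1 := by
    apply mul_left_cancel₀ hm
    linarith
  refine ⟨h3, ?_⟩
  rw [h3] at h2
  linarith

theorem aux_cross (a b : ℝ) (hab : a < b) (u u' : ℝ → ℂ)
    (hu' : ∀ x ∈ Set.Icc a b, HasDerivAt u (u' x) x)
    (hc : ContinuousOn u' (Set.Icc a b)) (hua : u a = 0) (hub : u b = 0) :
    ∫ x in a..b, u' x * ((e1' a b x : ℝ) : ℂ) =
      ((π ^ 2 / (b - a) ^ 2 : ℝ) : ℂ) * ∫ x in a..b, u x * ((e1 a b x : ℝ) : ℂ) := by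
  have hwc : ContinuousOn u (Set.Icc a b) :=
    fun x hx => (hu' x hx).continuousAt.continuousWithinAt
  have hu : Set.uIcc a b = Set.Icc a b := Set.uIcc_of_le hab.le
  have i1 : IntervalIntegrable (fun x => u x * ((e1 a b x : ℝ) : ℂ)) volume a b :=
    ContinuousOn.intervalIntegrable (by
      rw [hu]; exact hwc.mul (Complex.continuous_ofReal.comp (aux_e1_c a b)).continuousOn)
  have i2 : IntervalIntegrable (fun x => u' x * ((e1' a b x : ℝ) : ℂ)) volume a b :=
    ContinuousOn.intervalIntegrable (by
      rw [hu]; exact hc.mul (Complex.continuous_ofReal.comp (aux_e1'_c a b)).continuousOn)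
  have := intervalIntegral.integral_eq_sub_of_hasDerivAt (a := a) (b := b)
      (f := fun x => u x * ((e1' a b x : ℝ) : ℂ))
      (f' := fun x => u' x * ((e1' a b x : ℝ) : ℂ) -
        ((π ^ 2 / (b - a) ^ 2 : ℝ) : ℂ) * (u x * ((e1 a b x : ℝ) : ℂ)))
      (fun x hx => by
        refine ((hu' x (hu ▸ hx)).mul (aux_e1'_deriv a b x).ofReal_comp).congr_deriv ?_
        push_cast
        ring) (i2.sub (i1.const_mul _))
  rw [intervalIntegral.integral_sub i2 (i1.const_mul _),
    intervalIntegral.integral_const_mul, hua, hub] at this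
  simp only [zero_mul, sub_zero] at this
  exact sub_eq_zero.1 this

theorem aux_energy (a b : ℝ) (hab : a < b) (V : ℝ → ℝ) (s μ : ℝ)
    (f u u' u'' : ℝ → ℂ)
    (hu' : ∀ x ∈ Set.Icc a b, HasDerivAt u (u' x) x)
    (hu'' : ∀ x ∈ Set.Icc a b, HasDerivAt u' (u'' x) x)
    (hu''c : ContinuousOn u'' (Set.Icc a b))
    (hua : u a = 0) (hub : u b = 0)
    (heq : ∀ x ∈ Set.Icc a b,
      -u'' x - (μ : ℂ) * u x + Complex.I * ((V x - s : ℝ) : ℂ) * u x = f x) :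
    ∫ x in a..b, inner ℝ (u x) (f x) =
      (∫ x in a..b, ‖u' x‖ ^ 2) - μ * ∫ x in a..b, ‖u x‖ ^ 2 := by
  have hc0 : ContinuousOn u (Set.Icc a b) :=
    fun x hx => (hu' x hx).continuousAt.continuousWithinAt
  have hc1 : ContinuousOn u' (Set.Icc a b) :=
    fun x hx => (hu'' x hx).continuousAt.continuousWithinAt
  have hu : Set.uIcc a b = Set.Icc a b := Set.uIcc_of_le hab.le
  have i1 : IntervalIntegrable (fun x => ‖u x‖ ^ 2) volume a b :=
    ContinuousOn.intervalIntegrable (by rw [hu]; fun_prop)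
  have i2 : IntervalIntegrable (fun x => ‖u' x‖ ^ 2) volume a b :=
    ContinuousOn.intervalIntegrable (by rw [hu]; fun_prop)
  have i3 : IntervalIntegrable (fun x => inner ℝ (u x) (u'' x)
      + inner ℝ (u' x) (u' x)) volume a b :=
    ContinuousOn.intervalIntegrable (by rw [hu]; exact (hc0.inner hu''c).add (hc1.inner hc1))
  have h0 := intervalIntegral.integral_eq_sub_of_hasDerivAt (a := a) (b := b)
      (f := fun x => (inner ℝ (u x) (u' x) : ℝ))
      (fun x hx => (hu' x (hu ▸ hx)).inner ℝ (hu'' x (hu ▸ hx))) i3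
  simp only [hua, hub, inner_zero_left, sub_zero] at h0
  have e : ∫ x in a..b, inner ℝ (u x) (f x) = ∫ x in a..b,
      ((‖u' x‖ ^ 2 - μ * ‖u x‖ ^ 2) - (inner ℝ (u x) (u'' x) + inner ℝ (u' x) (u' x))) := by
    apply intervalIntegral.integral_congr
    intro x hx
    simp only [← heq x (hu ▸ hx)]
    simp only [Complex.inner, ← Complex.normSq_eq_norm_sq, Complex.normSq_apply]
    simp
    ring
  rw [e, intervalIntegral.integral_sub (i2.sub (i1.const_mul _)) i3, h0,
    intervalIntegral.integral_sub i2 (i1.const_mul _), intervalIntegral.integral_const_mul]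
  simp

theorem aux_gap (a b : ℝ) (hab : a < b) (u u' : ℝ → ℂ)
    (hu' : ∀ x ∈ Set.Icc a b, HasDerivAt u (u' x) x)
    (hc : ContinuousOn u' (Set.Icc a b)) (hua : u a = 0) (hub : u b = 0) :
    ∃ d : ℂ, 4 * (π ^ 2 / (b - a) ^ 2) * (∫ x in a..b, ‖u x - d * ((e1 a b x : ℝ) : ℂ)‖ ^ 2) ≤
      ∫ x in a..b, ‖u' x - d * ((e1' a b x : ℝ) : ℂ)‖ ^ 2 := by
  set m := (a + b) / 2 with hm
  have hL : 0 < b - a := by linarith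
  have hem : e1 a b m ≠ 0 := by
    have : π * (m - a) / (b - a) = π / 2 := by
      rw [hm]; field_simp; ring
    rw [e1, this, Real.sin_pi_div_two]
    have : 0 < Real.sqrt (2 / (b - a)) := Real.sqrt_pos.2 (by positivity)
    simpa using this.ne'
  have hemc : ((e1 a b m : ℝ) : ℂ) ≠ 0 := by exact_mod_cast hem
  let d : ℂ := u m / ((e1 a b m : ℝ) : ℂ)
  refine ⟨d, ?_⟩
  let w : ℝ → ℂ := fun x => u x - d * ((e1 a b x : ℝ) : ℂ)
  let w' : ℝ → ℂ := fun x => u' x - d * ((e1' a b x : ℝ) : ℂ)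
  have hw : ∀ x ∈ Set.Icc a b, HasDerivAt w (w' x) x := fun x hx =>
    (hu' x hx).sub ((aux_e1_deriv a b x).ofReal_comp.const_mul d)
  have hwc' : ContinuousOn w' (Set.Icc a b) := hc.sub
    (continuous_const.mul (Complex.continuous_ofReal.comp (aux_e1'_c a b))).continuousOn
  have hwc : ContinuousOn w (Set.Icc a b) :=
    fun x hx => (hw x hx).continuousAt.continuousWithinAt
  have ham : a < m := by rw [hm]; linarith
  have hmb : m < b := by rw [hm]; linarith
  have hwa : w a = 0 := by simp [w, hua, aux_e1_a]
  have hwb : w b = 0 := by simp [w, hub, aux_e1_b a b hab]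
  have hwm : w m = 0 := by simp [w, d, div_mul_cancel₀ _ hemc]
  have s1 : Set.Icc a m ⊆ Set.Icc a b := Set.Icc_subset_Icc_right hmb.le
  have s2 : Set.Icc m b ⊆ Set.Icc a b := Set.Icc_subset_Icc_left ham.le
  have hk0 : 0 < 2 * π / (b - a) := by have := Real.pi_pos; positivity
  have g1 := aux_wirt a m (2 * π / (b - a)) ham hk0 (by rw [hm]; field_simp; ring) w w'
    (fun x hx => hw x (s1 hx)) (hwc'.mono s1) hwa hwm
  have g2 := aux_wirt m b (2 * π / (b - a)) hmb hk0 (by rw [hm]; field_simp; ring) w w'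
    (fun x hx => hw x (s2 hx)) (hwc'.mono s2) hwm hwb
  have n1 : ContinuousOn (fun x => ‖w x‖ ^ 2) (Set.Icc a b) := by fun_prop
  have n2 : ContinuousOn (fun x => ‖w' x‖ ^ 2) (Set.Icc a b) := by fun_prop
  have u1 : Set.uIcc a m = Set.Icc a m := Set.uIcc_of_le ham.le
  have u2 : Set.uIcc m b = Set.Icc m b := Set.uIcc_of_le hmb.le
  have a1 := intervalIntegral.integral_add_adjacent_intervals (μ := volume)
    (u1 ▸ n1.mono s1 : ContinuousOn _ (Set.uIcc a m)).intervalIntegrable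
    (u2 ▸ n1.mono s2 : ContinuousOn _ (Set.uIcc m b)).intervalIntegrable
  have a2 := intervalIntegral.integral_add_adjacent_intervals (μ := volume)
    (u1 ▸ n2.mono s1 : ContinuousOn _ (Set.uIcc a m)).intervalIntegrable
    (u2 ▸ n2.mono s2 : ContinuousOn _ (Set.uIcc m b)).intervalIntegrable
  change 4 * (π ^ 2 / (b - a) ^ 2) * (∫ x in a..b, ‖w x‖ ^ 2) ≤ ∫ x in a..b, ‖w' x‖ ^ 2
  rw [← a1, ← a2]
  have hk : 4 * (π ^ 2 / (b - a) ^ 2) = (2 * π / (b - a)) ^ 2 := by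
    rw [div_pow]; ring
  rw [hk, mul_add]
  exact add_le_add g1 g2

theorem resolvent_perp_component_bounds
    (a b : ℝ) (hab : a < b) (V : ℝ → ℝ) (s : ℝ)
    (hVmeas : Measurable V) (hVbd : ∃ M : ℝ, ∀ x, |V x| ≤ M)
    (f u u' u'' : ℝ → ℂ)
    (hf : ContinuousOn f (Set.Icc a b))
    (hu' : ∀ x ∈ Set.Icc a b, HasDerivAt u (u' x) x)
    (hu'' : ∀ x ∈ Set.Icc a b, HasDerivAt u' (u'' x) x)
    (hu''c : ContinuousOn u'' (Set.Icc a b))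
    (hua : u a = 0) (hub : u b = 0)
    (heq : ∀ x ∈ Set.Icc a b,
      -u'' x - ((π ^ 2 / (b - a) ^ 2 : ℝ) : ℂ) * u x +
        Complex.I * ((V x - s : ℝ) : ℂ) * u x = f x) :
    (∫ x in a..b,
        ‖u x - (∫ y in a..b, u y * ((e1 a b y : ℝ) : ℂ)) * ((e1 a b x : ℝ) : ℂ)‖ ^ 2)
      ≤ Real.sqrt (∫ x in a..b, ‖f x‖ ^ 2) * Real.sqrt (∫ x in a..b, ‖u x‖ ^ 2) /
          (4 * π ^ 2 / (b - a) ^ 2 - π ^ 2 / (b - a) ^ 2) ∧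
    (∫ x in a..b,
        ‖u' x - (∫ y in a..b, u y * ((e1 a b y : ℝ) : ℂ)) * ((e1' a b x : ℝ) : ℂ)‖ ^ 2)
      ≤ (1 - (π ^ 2 / (b - a) ^ 2) / (4 * π ^ 2 / (b - a) ^ 2))⁻¹ *
          (Real.sqrt (∫ x in a..b, ‖f x‖ ^ 2) * Real.sqrt (∫ x in a..b, ‖u x‖ ^ 2)) := by
  have hc0 : ContinuousOn u (Set.Icc a b) :=
    fun x hx => (hu' x hx).continuousAt.continuousWithinAt
  have hc1 : ContinuousOn u' (Set.Icc a b) :=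
    fun x hx => (hu'' x hx).continuousAt.continuousWithinAt
  obtain ⟨d, hd⟩ := aux_gap a b hab u u' hu' hc1 hua hub
  have hen := aux_energy a b hab V s _ f u u' u'' hu' hu'' hu''c hua hub heq
  have hcs := aux_cs a b hab f u hf hc0
  have hcr := aux_cross a b hab u u' hu' hc1 hua hub
  obtain ⟨hn1, hn2⟩ := aux_norms a b hab
  have hL : 0 < b - a := by linarith
  have hμ : 0 < π ^ 2 / (b - a) ^ 2 := by have := Real.pi_pos; positivity
  have h4 : 4 * π ^ 2 / (b - a) ^ 2 = 4 * (π ^ 2 / (b - a) ^ 2) := by ring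
  rw [aux_expand a b hab u (e1 a b) d hc0 (aux_e1_c a b),
    aux_expand a b hab u' (e1' a b) d hc1 (aux_e1'_c a b), hcr, hn1, hn2] at hd
  rw [aux_expand a b hab u (e1 a b) _ hc0 (aux_e1_c a b),
    aux_expand a b hab u' (e1' a b) _ hc1 (aux_e1'_c a b), hcr, hn1, hn2, h4]
  rw [hen] at hcs
  generalize π ^ 2 / (b - a) ^ 2 = μ at *
  generalize (∫ x in a..b, u x * ((e1 a b x : ℝ) : ℂ)) = C at *
  generalize Real.sqrt (∫ x in a..b, ‖f x‖ ^ 2) * Real.sqrt (∫ x in a..b, ‖u x‖ ^ 2) = R at *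
  generalize (∫ x in a..b, ‖u x‖ ^ 2) = A at *
  generalize (∫ x in a..b, ‖u' x‖ ^ 2) = B at *
  have hin : ∀ z : ℂ, inner ℝ z ((μ : ℂ) * C) = μ * inner ℝ z C := by
    intro z
    rw [← Complex.real_smul, inner_smul_right]
  rw [hin] at hd ⊢
  rw [real_inner_self_eq_norm_sq]
  have hsq := sq_nonneg ‖d - C‖
  rw [norm_sub_sq_real] at hsq
  have hsq' := mul_nonneg hμ.le hsq
  have hq : (1 - μ / (4 * μ))⁻¹ = 4 / 3 := by
    field_simp
    norm_num
  rw [hq, le_div_iff₀ (by linarith)]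
  constructor <;> nlinarith
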